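/- Assume u, v : Ω → ℝ are g-convex and differentiable, and suppose for some x₀ ∈ Ω one has u(x₀) = v(x₀) and Du(x₀) ≠ Dv(x₀). Set Ω' := {x ∈ Ω : u(x) > v(x)} and Ξ := Y_v⁻¹(Y_u(Ω')). Then Ξ ⊂ Ω' and x₀ is at a positive distance from Ξ, i.e. there exists ε > 0 such that B_ε(x₀) ∩ Ξ = ∅. -/

import Mathlib

open Set MeasureTheory Metric NNReal

noncomputable section

/-- `ℝⁿ` as Euclidean space. -/
abbrev Euc (n : ℕ) := EuclideanSpace ℝ (Fin n)

variable {n : ℕ}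

/-- The partial gradient `g_x` of a generating function. -/
def gradX (g : Euc n → Euc n → ℝ → ℝ) (x y : Euc n) (z : ℝ) : Euc n :=
  gradient (fun x' => g x' y z) x

/-- The partial gradient `g_y` of a generating function. -/
def gradY (g : Euc n → Euc n → ℝ → ℝ) (x y : Euc n) (z : ℝ) : Euc n :=
  gradient (fun y' => g x y' z) y

/-- The partial derivative `g_z` of a generating function. -/
def gradZ (g : Euc n → Euc n → ℝ → ℝ) (x y : Euc n) (z : ℝ) : ℝ :=
  deriv (fun z' => g x y z') z

/-- The matrix of mixed derivatives `g_{x_i y_j}`. -/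
def matGXY (g : Euc n → Euc n → ℝ → ℝ) (x y : Euc n) (z : ℝ) : Matrix (Fin n) (Fin n) ℝ :=
  fun i j => gradient (fun y' => gradX g x y' z i) y j

/-- The vector of mixed derivatives `g_{x_i z}`. -/
def vecGXZ (g : Euc n → Euc n → ℝ → ℝ) (x y : Euc n) (z : ℝ) : Fin n → ℝ :=
  fun i => deriv (fun z' => gradX g x y z' i) z

/-- The matrix of second derivatives `g_{x_i x_j}`. -/
def matGXX (g : Euc n → Euc n → ℝ → ℝ) (x y : Euc n) (z : ℝ) : Matrix (Fin n) (Fin n) ℝ :=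
  fun i j => gradient (fun x' => gradX g x' y z i) x j

/-- The matrix `E = g_{xy} - (g_z)⁻¹ g_{xz} ⊗ g_y` from condition A2. -/
def matE (g : Euc n → Euc n → ℝ → ℝ) (x y : Euc n) (z : ℝ) : Matrix (Fin n) (Fin n) ℝ :=
  fun i j => matGXY g x y z i j - (gradZ g x y z)⁻¹ * vecGXZ g x y z i * gradY g x y z j

/-- The set `𝒰 = {(x, g(x,y,z), g_x(x,y,z)) : (x,y,z) ∈ Γ}`. -/
def USet (g : Euc n → Euc n → ℝ → ℝ) (Γ : Set (Euc n × Euc n × ℝ)) :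
    Set (Euc n × ℝ × Euc n) :=
  {w | ∃ x y z, (x, y, z) ∈ Γ ∧ w = (x, g x y z, gradX g x y z)}

/-- Condition A1: for each `(x,u,p) ∈ 𝒰` there is a unique `(y,z)` with `(x,y,z) ∈ Γ`,
`g(x,y,z) = u` and `g_x(x,y,z) = p`. -/
def CondA1 (g : Euc n → Euc n → ℝ → ℝ) (Γ : Set (Euc n × Euc n × ℝ)) : Prop :=
  ∀ x u p, (x, u, p) ∈ USet g Γ →
    ∃! yz : Euc n × ℝ, (x, yz.1, yz.2) ∈ Γ ∧ g x yz.1 yz.2 = u ∧ gradX g x yz.1 yz.2 = p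

/-- Condition A1*: for fixed `(y,z)` the map `x ↦ -g_y/g_z (x,y,z)` is injective. -/
def CondA1Star (g : Euc n → Euc n → ℝ → ℝ) (Γ : Set (Euc n × Euc n × ℝ)) : Prop :=
  ∀ y z, Set.InjOn (fun x => (-(gradZ g x y z))⁻¹ • gradY g x y z) {x | (x, y, z) ∈ Γ}

/-- Condition A2: `g_z < 0` and `det E ≠ 0` on `Γ`. -/
def CondA2 (g : Euc n → Euc n → ℝ → ℝ) (Γ : Set (Euc n × Euc n × ℝ)) : Prop :=
  ∀ x y z, (x, y, z) ∈ Γ → gradZ g x y z < 0 ∧ (matE g x y z).det ≠ 0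

/-- `Γ` is a domain whose sections `I(x,y) = {z : (x,y,z) ∈ Γ}` are open intervals. -/
def GammaDomain (Γ : Set (Euc n × Euc n × ℝ)) : Prop :=
  IsOpen Γ ∧ ∀ x y : Euc n, OrdConnected {z : ℝ | (x, y, z) ∈ Γ}

/-- `g(·,y₀,z₀)` is a `g`-support of `u` at `x₀` (relative to `Ω`). -/
def IsGSupport (g : Euc n → Euc n → ℝ → ℝ) (Γ : Set (Euc n × Euc n × ℝ)) (Ω : Set (Euc n))
    (u : Euc n → ℝ) (x₀ y₀ : Euc n) (z₀ : ℝ) : Prop :=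
  (x₀, y₀, z₀) ∈ Γ ∧ u x₀ = g x₀ y₀ z₀ ∧ ∀ x ∈ Ω, (x, y₀, z₀) ∈ Γ ∧ g x y₀ z₀ ≤ u x

/-- `u` is `g`-convex on `Ω`. -/
def GConvexOn (g : Euc n → Euc n → ℝ → ℝ) (Γ : Set (Euc n × Euc n × ℝ)) (Ω : Set (Euc n))
    (u : Euc n → ℝ) : Prop :=
  ∀ x₀ ∈ Ω, ∃ y₀ z₀, IsGSupport g Γ Ω u x₀ y₀ z₀

/-- The maps `Y`, `Z` solve `g(x,Y(x,u,p),Z(x,u,p)) = u`, `g_x(x,Y(x,u,p),Z(x,u,p)) = p`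
on `𝒰`, with values in `Γ`. -/
def YZCompat (g : Euc n → Euc n → ℝ → ℝ) (Γ : Set (Euc n × Euc n × ℝ))
    (Y : Euc n → ℝ → Euc n → Euc n) (Z : Euc n → ℝ → Euc n → ℝ) : Prop :=
  ∀ x u p, (x, u, p) ∈ USet g Γ →
    (x, Y x u p, Z x u p) ∈ Γ ∧ g x (Y x u p) (Z x u p) = u ∧
      gradX g x (Y x u p) (Z x u p) = p

/-- `Y_u(x) = Y(x, u(x), Du(x))`. -/
def YMap (Y : Euc n → ℝ → Euc n → Euc n) (u : Euc n → ℝ) (x : Euc n) : Euc n :=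
  Y x (u x) (gradient u x)

/-- `Z_u(x) = Z(x, u(x), Du(x))`. -/
def ZMap (Z : Euc n → ℝ → Euc n → ℝ) (u : Euc n → ℝ) (x : Euc n) : ℝ :=
  Z x (u x) (gradient u x)

/-- The one-jet of `u` lies in `𝒰` on `Ω`. -/
def JetInU (g : Euc n → Euc n → ℝ → ℝ) (Γ : Set (Euc n × Euc n × ℝ)) (Ω : Set (Euc n))
    (u : Euc n → ℝ) : Prop :=
  ∀ x ∈ Ω, (x, u x, gradient u x) ∈ USet g Γ

/-- `u ∈ C^{1,1}(Ω)`: continuously differentiable with locally Lipschitz gradient. -/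
def C11On (Ω : Set (Euc n)) (u : Euc n → ℝ) : Prop :=
  (∀ x ∈ Ω, DifferentiableAt ℝ u x) ∧ ContinuousOn (fun x => gradient u x) Ω ∧
    ∀ x ∈ Ω, ∃ ε > 0, ∃ K : ℝ≥0, LipschitzOnWith K (fun y => gradient u y) (ball x ε ∩ Ω)

/-- `u` is a generalized solution of the generated Jacobian equation:
`∫_{Y_u(E)} f* = ∫_E f` for every measurable `E ⊆ Ω`. -/
def IsGenSol (Y : Euc n → ℝ → Euc n → Euc n) (Ω : Set (Euc n)) (f fstar : Euc n → ℝ)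
    (u : Euc n → ℝ) : Prop :=
  ∀ s ⊆ Ω, MeasurableSet s → ∫ y in YMap Y u '' s, fstar y = ∫ x in s, f x

/-- The second derivative (Hessian) matrix of `u` at `x`. -/
def Hess (u : Euc n → ℝ) (x : Euc n) : Matrix (Fin n) (Fin n) ℝ :=
  fun i j => (fderiv ℝ (fun y => gradient u y) x) (EuclideanSpace.single j 1) i

end

open Set MeasureTheory Metric

open Filter Topology InnerProductSpace

theorem fderiv_prod_apply_eq_sum {n : ℕ} {f : Euc n × Euc n × ℝ → ℝ} {x y : Euc n} {z : ℝ}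
    (hf : DifferentiableAt ℝ f (x, y, z)) (b : Euc n) (c : ℝ) :
    fderiv ℝ f (x, y, z) (0, b, c) =
      ∑ j, gradient (fun y' => f (x, y', z)) y j * b j + deriv (fun z' => f (x, y, z')) z * c := by
  have h1 : HasFDerivAt (fun y' : Euc n => (x, y', z))
      ((0 : Euc n →L[ℝ] Euc n).prod ((ContinuousLinearMap.id ℝ (Euc n)).prod 0)) y :=
    (hasFDerivAt_const x y).prodMk ((hasFDerivAt_id y).prodMk (hasFDerivAt_const z y))
  have h2 : HasDerivAt (fun z' : ℝ => (x, y, z')) ((0 : Euc n), (0 : Euc n), (1 : ℝ)) z :=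
    (hasDerivAt_const z x).prodMk ((hasDerivAt_const z y).prodMk (hasDerivAt_id z))
  have h3 := (hf.hasFDerivAt.comp y h1).fderiv
  have h4 := (hf.hasFDerivAt.comp_hasDerivAt z h2).deriv
  have h5 : fderiv ℝ f (x, y, z) (0, b, 0) = ∑ j, gradient (fun y' => f (x, y', z)) y j * b j := by
    have : inner ℝ (gradient (fun y' => f (x, y', z)) y) b = fderiv ℝ f (x, y, z) (0, b, 0) := by
      rw [inner_gradient_left]
      have := congrArg (fun L => L b) h3
      simpa [Function.comp_def] using this
    rw [← this, PiLp.inner_apply]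
    simp [mul_comm]
  have h6 : ((0 : Euc n), b, c) = (0, b, 0) + c • ((0 : Euc n), (0 : Euc n), (1 : ℝ)) := by
    simp
  rw [h6, map_add, map_smul, h5]
  simp only [Function.comp_def] at h4
  rw [h4, smul_eq_mul, mul_comm c]

section GeneratingFunction

variable {n : ℕ} {Γ : Set (Euc n × Euc n × ℝ)} {g : Euc n → Euc n → ℝ → ℝ}

theorem hasFDerivAt_generating (hΓ : IsOpen Γ)
    (hg : ContDiffOn ℝ 4 (fun w : Euc n × Euc n × ℝ => g w.1 w.2.1 w.2.2) Γ)
    {x y : Euc n} {z : ℝ} (hw : (x, y, z) ∈ Γ) :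
    HasFDerivAt (fun x' => g x' y z)
      ((fderiv ℝ (fun w : Euc n × Euc n × ℝ => g w.1 w.2.1 w.2.2) (x, y, z)).comp
        (ContinuousLinearMap.inl ℝ (Euc n) (Euc n × ℝ))) x := by
  have hd := ((hg.contDiffAt (hΓ.mem_nhds hw)).differentiableAt (by norm_num)).hasFDerivAt
  exact HasFDerivAt.comp (f := fun x' => (x', y, z))
    (g := fun w : Euc n × Euc n × ℝ => g w.1 w.2.1 w.2.2) x hd (hasFDerivAt_prodMk_left x (y, z))

theorem contDiffAt_gradX (hΓ : IsOpen Γ)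
    (hg : ContDiffOn ℝ 4 (fun w : Euc n × Euc n × ℝ => g w.1 w.2.1 w.2.2) Γ)
    {w : Euc n × Euc n × ℝ} (hw : w ∈ Γ) :
    ContDiffAt ℝ 3 (fun w : Euc n × Euc n × ℝ => gradX g w.1 w.2.1 w.2.2) w := by
  have h1 : ContDiffAt ℝ 3
      (fderiv ℝ (fun w : Euc n × Euc n × ℝ => g w.1 w.2.1 w.2.2)) w :=
    (hg.contDiffAt (hΓ.mem_nhds hw)).fderiv_right (by norm_num)
  have h2 : ContDiffAt ℝ 3 (fun w => (toDual ℝ (Euc n)).symm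
      ((fderiv ℝ (fun w : Euc n × Euc n × ℝ => g w.1 w.2.1 w.2.2) w).comp
        (ContinuousLinearMap.inl ℝ (Euc n) (Euc n × ℝ)))) w :=
    ((toDual ℝ (Euc n)).symm.contDiff.contDiffAt).comp w (h1.clm_comp contDiffAt_const)
  refine h2.congr_of_eventuallyEq ?_
  filter_upwards [hΓ.mem_nhds hw] with w' hw'
  exact congrArg _ (hasFDerivAt_generating hΓ hg hw').fderiv

theorem map_nhds_jet (hΓ : IsOpen Γ)
    (hg : ContDiffOn ℝ 4 (fun w : Euc n × Euc n × ℝ => g w.1 w.2.1 w.2.2) Γ)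
    (hA2 : CondA2 g Γ) {x y : Euc n} {z : ℝ} (hw : (x, y, z) ∈ Γ) :
    map (fun w : Euc n × Euc n × ℝ => (w.1, g w.1 w.2.1 w.2.2, gradX g w.1 w.2.1 w.2.2))
      (𝓝 (x, y, z)) = 𝓝 (x, g x y z, gradX g x y z) := by
  have hG := hg.contDiffAt (hΓ.mem_nhds hw)
  have hP := contDiffAt_gradX hΓ hg hw
  have hGs := hG.hasStrictFDerivAt (by norm_num)
  have hPs := hP.hasStrictFDerivAt (by norm_num)
  have hF := (hasStrictFDerivAt_fst (𝕜 := ℝ) (p := (x, y, z))).prodMk (hGs.prodMk hPs)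
  have hcoord : ∀ (b : Euc n) (c : ℝ) (i : Fin n),
      (fderiv ℝ (fun w : Euc n × Euc n × ℝ => gradX g w.1 w.2.1 w.2.2) (x, y, z) (0, b, c)) i =
        ∑ j, matGXY g x y z i j * b j + vecGXZ g x y z i * c := by
    intro b c i
    have hPi : HasFDerivAt (fun w : Euc n × Euc n × ℝ => gradX g w.1 w.2.1 w.2.2 i)
        ((EuclideanSpace.proj i : Euc n →L[ℝ] ℝ).comp
          (fderiv ℝ (fun w : Euc n × Euc n × ℝ => gradX g w.1 w.2.1 w.2.2) (x, y, z)))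
        (x, y, z) :=
      (EuclideanSpace.proj i : Euc n →L[ℝ] ℝ).hasFDerivAt.comp _ hPs.hasFDerivAt
    have := fderiv_prod_apply_eq_sum hPi.differentiableAt b c
    rw [hPi.fderiv] at this
    exact this
  refine hF.map_nhds_eq_of_surj ?_
  refine LinearMap.range_eq_top.2 ?_
  refine (LinearMap.injective_iff_surjective_of_finrank_eq_finrank ?_).1 ?_
  · simp [Module.finrank_prod, add_comm]
  rw [injective_iff_map_eq_zero]
  rintro ⟨a, b, c⟩ h0
  obtain ⟨ha, h1, h2⟩ : a = 0 ∧
      fderiv ℝ (fun w : Euc n × Euc n × ℝ => g w.1 w.2.1 w.2.2) (x, y, z) (a, b, c) = 0 ∧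
      fderiv ℝ (fun w : Euc n × Euc n × ℝ => gradX g w.1 w.2.1 w.2.2) (x, y, z) (a, b, c) = 0 := by
    simpa [Prod.ext_iff] using h0
  subst ha
  obtain ⟨hz, hdet⟩ := hA2 x y z hw
  have h3 : ∑ j, gradY g x y z j * b j + gradZ g x y z * c = 0 :=
    (fderiv_prod_apply_eq_sum (hG.differentiableAt (by norm_num)) b c).symm.trans h1
  have hc : c = -((gradZ g x y z)⁻¹ * ∑ j, gradY g x y z j * b j) := by
    field_simp [hz.ne]
    linarith
  have hb : b.ofLp = 0 := by
    refine Matrix.eq_zero_of_mulVec_eq_zero hdet (funext fun i => ?_)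
    have h4 := hcoord b c i
    rw [h2, hc] at h4
    simp only [Matrix.mulVec, dotProduct, matE, Pi.zero_apply, sub_mul, Finset.sum_sub_distrib]
    simp only [PiLp.zero_apply] at h4
    rw [h4, Finset.mul_sum, mul_neg, Finset.mul_sum, sub_eq_add_neg]
    congr 2
    exact Finset.sum_congr rfl fun j _ => by ring
  have hb' : b = 0 := by
    ext i
    exact congrFun hb i
  subst hb'
  simp [hc]

/-- The pair `(y, z)` depends continuously on the one-jet of `g(·, y, z)`: jets near that of
`(x, y, z)` are attained only by pairs in a prescribed neighbourhood of `(y, z)`. -/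
theorem CondA1.eventually_mem_of_jet (hA1 : CondA1 g Γ) (hΓ : IsOpen Γ)
    (hg : ContDiffOn ℝ 4 (fun w : Euc n × Euc n × ℝ => g w.1 w.2.1 w.2.2) Γ)
    (hA2 : CondA2 g Γ) {x y : Euc n} {z : ℝ} (hw : (x, y, z) ∈ Γ)
    {N : Set (Euc n × ℝ)} (hN : N ∈ 𝓝 (y, z)) :
    ∀ᶠ j in 𝓝 (x, g x y z, gradX g x y z), ∀ y' z', (j.1, y', z') ∈ Γ →
      g j.1 y' z' = j.2.1 → gradX g j.1 y' z' = j.2.2 → (y', z') ∈ N := by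
  have hmem : {w : Euc n × Euc n × ℝ | w ∈ Γ ∧ w.2 ∈ N} ∈ 𝓝 (x, y, z) :=
    inter_mem (hΓ.mem_nhds hw) (continuousAt_snd.preimage_mem_nhds hN)
  rw [← map_nhds_jet hΓ hg hA2 hw, eventually_map]
  filter_upwards [hmem] with w hw' y' z' hΓ' hg' hp'
  have := (hA1 w.1 _ _ ⟨w.1, w.2.1, w.2.2, hw'.1, rfl⟩).unique (y₁ := (y', z')) (y₂ := w.2)
    ⟨hΓ', hg', hp'⟩ ⟨hw'.1, rfl, rfl⟩
  exact this ▸ hw'.2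

theorem IsGSupport.gradX_eq {Ω : Set (Euc n)} {u : Euc n → ℝ} {x y : Euc n} {z : ℝ}
    (h : IsGSupport g Γ Ω u x y z) (hΓ : IsOpen Γ)
    (hg : ContDiffOn ℝ 4 (fun w : Euc n × Euc n × ℝ => g w.1 w.2.1 w.2.2) Γ)
    (hΩ : IsOpen Ω) (hx : x ∈ Ω) (hu : DifferentiableAt ℝ u x) :
    gradX g x y z = gradient u x := by
  have hd := hasFDerivAt_generating hΓ hg h.1
  have hmax : IsLocalMax (fun x' => g x' y z - u x') x := by
    filter_upwards [hΩ.mem_nhds hx] with x' hx'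
    have := (h.2.2 x' hx').2
    have := h.2.1
    linarith
  have h0 := hmax.hasFDerivAt_eq_zero (hd.sub hu.hasFDerivAt)
  have h1 : fderiv ℝ (fun x' => g x' y z) x = fderiv ℝ u x := hd.fderiv.trans (sub_eq_zero.1 h0)
  simp only [gradX, gradient, h1]

theorem GConvexOn.isGSupport_YMap_ZMap {Ω : Set (Euc n)} {u : Euc n → ℝ}
    {Y : Euc n → ℝ → Euc n → Euc n} {Z : Euc n → ℝ → Euc n → ℝ} (hu : GConvexOn g Γ Ω u)
    (hΓ : IsOpen Γ) (hg : ContDiffOn ℝ 4 (fun w : Euc n × Euc n × ℝ => g w.1 w.2.1 w.2.2) Γ)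
    (hA1 : CondA1 g Γ) (hYZ : YZCompat g Γ Y Z) (hΩ : IsOpen Ω)
    (hud : ∀ x ∈ Ω, DifferentiableAt ℝ u x) {x : Euc n} (hx : x ∈ Ω) :
    IsGSupport g Γ Ω u x (YMap Y u x) (ZMap Z u x) := by
  obtain ⟨y, z, h⟩ := hu x hx
  have hgrad := h.gradX_eq hΓ hg hΩ hx (hud x hx)
  have hU : (x, u x, gradient u x) ∈ USet g Γ := ⟨x, y, z, h.1, by rw [hgrad, h.2.1]⟩
  have := (hA1 _ _ _ hU).unique (y₁ := (y, z)) (y₂ := (YMap Y u x, ZMap Z u x))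
    ⟨h.1, h.2.1.symm, hgrad⟩ (hYZ _ _ _ hU)
  obtain ⟨rfl, rfl⟩ := Prod.ext_iff.1 this
  exact h

end GeneratingFunction

/-- If `h ≤ v` and `h` touches `v` close enough to `x₀`, then the one-jet of `h` comes
close to the one-jet of `v` at `x₀` (possibly away from the touching point). -/
theorem eventually_exists_jet_mem {E : Type*} [NormedAddCommGroup E] [InnerProductSpace ℝ E]
    [FiniteDimensional ℝ E] {Ω : Set E} (hΩ : IsOpen Ω) {v : E → ℝ} {x₀ : E} (hx₀ : x₀ ∈ Ω)
    (hv : DifferentiableAt ℝ v x₀) {W : Set (E × ℝ × E)}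
    (hW : W ∈ 𝓝 (x₀, v x₀, gradient v x₀)) :
    ∀ᶠ ξ in 𝓝 x₀, ∀ h : E → ℝ, (∀ x ∈ Ω, DifferentiableAt ℝ h x) → (∀ x ∈ Ω, h x ≤ v x) →
      h ξ = v ξ → ∃ x ∈ Ω, (x, h x, gradient h x) ∈ W := by
  obtain ⟨r, hr, hrW⟩ := Metric.mem_nhds_iff.1 hW
  set p := gradient v x₀ with hp
  set η := r / 4 with hη
  have hη0 : 0 < η := by positivity
  have hgr : ∀ᶠ x in 𝓝 x₀, |v x - v x₀ - inner ℝ p (x - x₀)| ≤ η / 2 * ‖x - x₀‖ := by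
    have := (hasGradientAt_iff_isLittleO.1 hv.hasGradientAt).def (half_pos hη0)
    simpa only [Real.norm_eq_abs] using this
  obtain ⟨δ, hδ, hδv⟩ := Metric.eventually_nhds_iff_ball.1 (hgr.and (hΩ.mem_nhds hx₀))
  obtain ⟨ρ, hρ, hρδ, hρr⟩ : ∃ ρ > 0, ρ < δ ∧ (‖p‖ + η + 1) * ρ < r := by
    refine ⟨min (δ / 2) (r / (2 * (‖p‖ + η + 1))), by positivity, ?_, ?_⟩
    · exact (min_le_left _ _).trans_lt (by linarith)
    · calc (‖p‖ + η + 1) * min (δ / 2) (r / (2 * (‖p‖ + η + 1)))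
          ≤ (‖p‖ + η + 1) * (r / (2 * (‖p‖ + η + 1))) := by gcongr; exact min_le_right _ _
        _ = r / 2 := by field_simp
        _ < r := by linarith
  have hnear : ∀ x ∈ closedBall x₀ ρ,
      |v x - v x₀ - inner ℝ p (x - x₀)| ≤ η / 2 * ‖x - x₀‖ ∧ x ∈ Ω := fun x hx =>
    hδv x (closedBall_subset_ball hρδ hx)
  filter_upwards [ball_mem_nhds x₀ (by positivity : 0 < ρ / 4)] with ξ hξ h hhd hhv hhξ
  set q : E → ℝ := fun x => h x - inner ℝ p (x - x₀) - η / ρ * ‖x - x₀‖ ^ 2 with hq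
  have hξρ : ξ ∈ closedBall x₀ ρ := by
    rw [mem_ball] at hξ
    rw [mem_closedBall]
    linarith
  have hqξ : v x₀ - η * ρ / 2 < q ξ := by
    have h1 := (abs_le.1 (hnear ξ hξρ).1).1
    have hd : ‖ξ - x₀‖ < ρ / 4 := by rwa [← mem_ball_iff_norm]
    have h2 : η / ρ * ‖ξ - x₀‖ ^ 2 ≤ η / ρ * (ρ / 4) ^ 2 := by gcongr
    have h3 : η / ρ * (ρ / 4) ^ 2 = η * ρ / 16 := by field_simp; norm_num
    have h4 : η / 2 * ‖ξ - x₀‖ ≤ η / 2 * (ρ / 4) := by gcongr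
    have h5 : 0 < η * ρ := by positivity
    simp only [hq, hhξ]
    linarith
  have hqd : ∀ x ∈ closedBall x₀ ρ, HasFDerivAt q
      (fderiv ℝ h x - innerSL ℝ p - (η / ρ) • (2 • innerSL ℝ (x - x₀))) x := by
    intro x hx
    have h1 : HasFDerivAt (fun x => x - x₀) (ContinuousLinearMap.id ℝ E) x :=
      (hasFDerivAt_id x).sub_const x₀
    have h2 := (innerSL ℝ p).hasFDerivAt.comp x h1
    have h3 := (h1.norm_sq).const_mul (η / ρ)
    exact ((hhd x (hnear x hx).2).hasFDerivAt.sub h2).sub h3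
  obtain ⟨x, hx, hxmax⟩ := (isCompact_closedBall x₀ ρ).exists_isMaxOn ⟨ξ, hξρ⟩
    (fun x hx => (hqd x hx).continuousAt.continuousWithinAt)
  have hqx : v x₀ - η * ρ / 2 < q x := hqξ.trans_le (hxmax hξρ)
  have hv1 := (abs_le.1 (hnear x hx).1)
  have hhx := hhv x (hnear x hx).2
  have hxn : ‖x - x₀‖ ≤ ρ := by rwa [← mem_closedBall_iff_norm]
  have hxlt : ‖x - x₀‖ < ρ := by
    refine hxn.lt_of_ne fun he => ?_
    have h3 : η / ρ * ρ ^ 2 = η * ρ := by field_simp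
    simp only [hq, he, h3] at hqx
    rw [he] at hv1
    linarith [hv1.2]
  have hlm : IsLocalMax q x := by
    filter_upwards [isOpen_ball.mem_nhds (mem_ball_iff_norm.2 hxlt)] with x' hx'
    exact hxmax (ball_subset_closedBall hx')
  have h0 := hlm.hasFDerivAt_eq_zero (hqd x hx)
  have hgh : gradient h x = p + (2 * (η / ρ)) • (x - x₀) := by
    refine ext_inner_right ℝ fun w => ?_
    have := congrArg (fun L => L w) h0
    simp [-map_sub] at this
    rw [inner_gradient_left, inner_add_left, real_inner_smul_left]
    linarith
  refine ⟨x, (hnear x hx).2, hrW ?_⟩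
  have hpin : |inner ℝ p (x - x₀)| ≤ ‖p‖ * ρ :=
    (abs_real_inner_le_norm _ _).trans (by gcongr)
  have hpin' := abs_le.1 hpin
  have hηn : η / 2 * ‖x - x₀‖ ≤ η / 2 * ρ := by gcongr
  have hsq : 0 ≤ η / ρ * ‖x - x₀‖ ^ 2 := by positivity
  have hηρ : 0 < η * ρ := by positivity
  have hpρ : 0 ≤ ‖p‖ * ρ := by positivity
  rw [mem_ball, Prod.dist_eq, Prod.dist_eq, max_lt_iff, max_lt_iff]
  refine ⟨?_, ?_, ?_⟩
  · rw [dist_eq_norm]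
    dsimp only
    linarith
  · rw [Real.dist_eq, abs_lt]
    simp only [hq] at hqx
    dsimp only
    constructor <;> linarith [hv1.1, hv1.2, hpin'.1, hpin'.2]
  · dsimp only
    rw [hgh, dist_eq_norm, add_sub_cancel_left, norm_smul, Real.norm_of_nonneg (by positivity)]
    calc 2 * (η / ρ) * ‖x - x₀‖ ≤ 2 * (η / ρ) * ρ := by gcongr
      _ = 2 * η := by field_simp
      _ < r := by linarith

theorem strictAntiOn_generating {n : ℕ} {Γ : Set (Euc n × Euc n × ℝ)}
    {g : Euc n → Euc n → ℝ → ℝ} (hΓ : GammaDomain Γ)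
    (hg : ContDiffOn ℝ 4 (fun w : Euc n × Euc n × ℝ => g w.1 w.2.1 w.2.2) Γ)
    (hA2 : CondA2 g Γ) (x y : Euc n) : StrictAntiOn (g x y) {z | (x, y, z) ∈ Γ} := by
  refine strictAntiOn_of_deriv_neg (hΓ.2 x y).convex ?_ fun z hz => (hA2 x y z ?_).1
  · exact hg.continuousOn.comp (f := fun z => (x, y, z)) (by fun_prop) fun z hz => hz
  · exact interior_subset (s := {z | (x, y, z) ∈ Γ}) hz

/-- **Lemma 3.1.** If `u, v` are `g`-convex and differentiable, `u(x₀) = v(x₀)` and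
`Du(x₀) ≠ Dv(x₀)`, then with `Ω' = {u > v}` and `Ξ = Y_v⁻¹(Y_u(Ω'))` one has `Ξ ⊆ Ω'`
and `x₀` is a positive distance from `Ξ`. -/
theorem support_separation_lemma
    {n : ℕ} {Ω Ωs : Set (Euc n)} {Γ : Set (Euc n × Euc n × ℝ)}
    {g : Euc n → Euc n → ℝ → ℝ} {Y : Euc n → ℝ → Euc n → Euc n} {Z : Euc n → ℝ → Euc n → ℝ}
    {u v : Euc n → ℝ} {x₀ : Euc n}
    (hΩ : IsOpen Ω) (hΩconn : IsConnected Ω) (hΩbdd : Bornology.IsBounded Ω)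
    (hΓ : GammaDomain Γ)
    (hg : ContDiffOn ℝ 4 (fun w : Euc n × Euc n × ℝ => g w.1 w.2.1 w.2.2) Γ)
    (hA1 : CondA1 g Γ) (hA1s : CondA1Star g Γ) (hA2 : CondA2 g Γ)
    (hYZ : YZCompat g Γ Y Z)
    (hudiff : ∀ x ∈ Ω, DifferentiableAt ℝ u x) (hvdiff : ∀ x ∈ Ω, DifferentiableAt ℝ v x)
    (hugc : GConvexOn g Γ Ω u) (hvgc : GConvexOn g Γ Ω v)
    (hujet : JetInU g Γ Ω u) (hvjet : JetInU g Γ Ω v)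
    (hx₀ : x₀ ∈ Ω) (heq : u x₀ = v x₀) (hgrad : gradient u x₀ ≠ gradient v x₀) :
    {ξ ∈ Ω | YMap Y v ξ ∈ YMap Y u '' {x ∈ Ω | v x < u x}} ⊆ {x ∈ Ω | v x < u x} ∧
      ∃ ε > 0, ball x₀ ε ∩ {ξ ∈ Ω | YMap Y v ξ ∈ YMap Y u '' {x ∈ Ω | v x < u x}} = ∅ := by
  have hu := fun {x} (hx : x ∈ Ω) =>
    hugc.isGSupport_YMap_ZMap hΓ.1 hg hA1 hYZ hΩ hudiff hx
  have hv := fun {x} (hx : x ∈ Ω) =>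
    hvgc.isGSupport_YMap_ZMap hΓ.1 hg hA1 hYZ hΩ hvdiff hx
  have hlt : ∀ ξ ∈ Ω, YMap Y v ξ ∈ YMap Y u '' {x ∈ Ω | v x < u x} →
      ∀ x ∈ Ω, g x (YMap Y v ξ) (ZMap Z v ξ) < u x := by
    rintro ξ hξ ⟨x', ⟨hx', hvu⟩, hY⟩ x hx
    have hux' := hu hx'
    have hvξ := hv hξ
    rw [hY] at hux'
    have hz : ZMap Z u x' < ZMap Z v ξ := by
      rw [← (strictAntiOn_generating hΓ hg hA2 x' (YMap Y v ξ)).lt_iff_gt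
        (hvξ.2.2 x' hx').1 hux'.1]
      exact ((hvξ.2.2 x' hx').2.trans_lt hvu).trans_eq hux'.2.1
    exact (strictAntiOn_generating hΓ hg hA2 x (YMap Y v ξ) (hux'.2.2 x hx).1
      (hvξ.2.2 x hx).1 hz).trans_le (hux'.2.2 x hx).2
  refine ⟨fun ξ hξ => ⟨hξ.1, ?_⟩, ?_⟩
  · rw [(hv hξ.1).2.1]
    exact hlt ξ hξ.1 hξ.2 ξ hξ.1
  have hv₀ := hv hx₀
  have hgv := hv₀.gradX_eq hΓ.1 hg hΩ hx₀ (hvdiff x₀ hx₀)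
  by_contra! hcon
  have hfreq : ∃ᶠ w in 𝓝 (YMap Y v x₀, ZMap Z v x₀), ∀ x ∈ Ω, g x w.1 w.2 ≤ u x := by
    rw [frequently_iff]
    intro N hN
    have hW := hA1.eventually_mem_of_jet hΓ.1 hg hA2 hv₀.1 hN
    rw [hgv, ← hv₀.2.1] at hW
    obtain ⟨ε, hε, hball⟩ := Metric.eventually_nhds_iff_ball.1
      (eventually_exists_jet_mem hΩ hx₀ (hvdiff x₀ hx₀) hW)
    obtain ⟨ξ, hξε, hξ, hξY⟩ := hcon ε hε
    have hvξ := hv hξ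
    obtain ⟨x, hx, hxW⟩ := hball ξ hξε (fun x => g x (YMap Y v ξ) (ZMap Z v ξ))
      (fun x hx => (hasFDerivAt_generating hΓ.1 hg (hvξ.2.2 x hx).1).differentiableAt)
      (fun x hx => (hvξ.2.2 x hx).2) hvξ.2.1.symm
    exact ⟨_, hxW _ _ (hvξ.2.2 x hx).1 rfl rfl, fun x' hx' => (hlt ξ hξ hξY x' hx').le⟩
  have hsupp : IsGSupport g Γ Ω u x₀ (YMap Y v x₀) (ZMap Z v x₀) := by
    refine ⟨hv₀.1, heq.trans hv₀.2.1, fun x hx => ⟨(hv₀.2.2 x hx).1, ?_⟩⟩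
    have hc : ContinuousAt (fun w : Euc n × ℝ => g x w.1 w.2) (YMap Y v x₀, ZMap Z v x₀) :=
      ContinuousAt.comp (f := fun w : Euc n × ℝ => (x, w))
        (g := fun w : Euc n × Euc n × ℝ => g w.1 w.2.1 w.2.2)
        (hg.contDiffAt (hΓ.1.mem_nhds (hv₀.2.2 x hx).1)).continuousAt
        (by fun_prop)
    exact le_of_tendsto_of_frequently hc (hfreq.mono fun w hw => hw x hx)
  exact hgrad ((hsupp.gradX_eq hΓ.1 hg hΩ hx₀ (hudiff x₀ hx₀)).symm.trans hgv)
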